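/- arXiv:1907.05614 — 3 statements merged into one kernel-verified Lean document; each statement's English description precedes it below -/
import Mathlib

section
/- Let X be a real Hilbert space, b a bounded coercive bilinear form on X with coercivity constant γ > 0, l a bounded linear functional on X, and Y, Z finite-dimensional subspaces of X with Y ∩ Z = {0}. Suppose x = y + z with y ∈ Y and z ∈ Z solves the Galerkin problem on X_i = Y ⊕ Z, i.e. b(x, w) = l(w) for all w ∈ X_i. Then: (a) b(z, w) = l(w) − b(y, w) for all w ∈ Z (i.e. z is the static condensation of l − A y on Z); and (b) for every v ∈ Y and every r_v, s_y, t_l ∈ Z satisfying b(r_v, w) = b(w, v), b(s_y, w) = b(y, w), and b(t_l, w) = l(w) for all w ∈ Z, the condensed variational equation b(y, v) − b(r_v, s_y) = l(v) − b(r_v, t_l) holds. -/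
/-- If `x = y + z` (with `y ∈ Y`, `z ∈ Z`, `Y ⊓ Z = ⊥`, `Y`, `Z` finite dimensional) solves
the Galerkin problem `b x w = l w` for all `w ∈ Y ⊔ Z`, where `b` is a bounded coercive
bilinear form and `l` a bounded linear functional, then (a) `z` is the static condensation of
`l - A y` on `Z`, and (b) `y` solves the condensed variational formulation. -/
theorem galerkin_implies_condensed
    {X : Type*} [NormedAddCommGroup X] [InnerProductSpace ℝ X] [CompleteSpace X]
    (b : X →ₗ[ℝ] X →ₗ[ℝ] ℝ) (M γ : ℝ) (hγ : 0 < γ)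
    (hbound : ∀ u w : X, |b u w| ≤ M * ‖u‖ * ‖w‖)
    (hcoer : ∀ u : X, γ * ‖u‖ ^ 2 ≤ b u u)
    (l : X →L[ℝ] ℝ)
    (Y Z : Submodule ℝ X) [FiniteDimensional ℝ Y] [FiniteDimensional ℝ Z]
    (hYZ : Y ⊓ Z = ⊥)
    (y z : X) (hy : y ∈ Y) (hz : z ∈ Z)
    (hGal : ∀ w ∈ Y ⊔ Z, b (y + z) w = l w) :
    (∀ w ∈ Z, b z w = l w - b y w) ∧
    (∀ v ∈ Y, ∀ rv ∈ Z, ∀ sy ∈ Z, ∀ tl ∈ Z,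
      (∀ w ∈ Z, b rv w = b w v) →
      (∀ w ∈ Z, b sy w = b y w) →
      (∀ w ∈ Z, b tl w = l w) →
      b y v - b rv sy = l v - b rv tl) := by
  have hcond : ∀ w ∈ Z, b z w = l w - b y w := by
    intro w hw
    have h := hGal w (Submodule.mem_sup_right hw)
    rw [map_add, LinearMap.add_apply] at h
    linarith
  refine ⟨hcond, fun v hv rv _ sy hsy tl htl hrv hs ht => ?_⟩
  have hz_eq : tl - sy = z := by
    have hmem : tl - sy - z ∈ Z := Z.sub_mem (Z.sub_mem htl hsy) hz
    have hzero : b (tl - sy - z) (tl - sy - z) = 0 := by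
      have h₁ := hcond _ hmem
      have h₂ := hs _ hmem
      have h₃ := ht _ hmem
      rw [map_sub b (tl - sy) z, map_sub b tl sy, LinearMap.sub_apply, LinearMap.sub_apply]
      linarith
    have hle := hcoer (tl - sy - z)
    rw [hzero] at hle
    have hsq : ‖tl - sy - z‖ ^ 2 = 0 :=
      le_antisymm (nonpos_of_mul_nonpos_right hle hγ) (sq_nonneg _)
    exact sub_eq_zero.mp (norm_eq_zero.mp (pow_eq_zero_iff two_ne_zero |>.mp hsq))
  have h := hGal v (Submodule.mem_sup_left hv)
  rw [← hz_eq, map_add, map_sub, LinearMap.add_apply, LinearMap.sub_apply] at h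
  rw [hrv sy hsy, hrv tl htl]
  linarith
end

section
/- Let X be a real Hilbert space, b a bounded coercive bilinear form on X with coercivity constant γ > 0, l a bounded linear functional on X, and Y, Z finite-dimensional subspaces of X with Y ∩ Z = {0}. Let y ∈ Y, and suppose there are elements s_y, t_l ∈ Z with b(s_y, w) = b(y, w) and b(t_l, w) = l(w) for all w ∈ Z, and that for every v ∈ Y and every r_v ∈ Z satisfying b(r_v, w) = b(w, v) for all w ∈ Z the condensed variational equation b(y, v) − b(r_v, s_y) = l(v) − b(r_v, t_l) holds. Let z ∈ Z satisfy b(z, w) = l(w) − b(y, w) for all w ∈ Z. If in addition for every v ∈ Y there exists r_v ∈ Z with b(r_v, w) = b(w, v) for all w ∈ Z, then x = y + z solves the Galerkin problem on X_i = Y ⊕ Z, i.e. b(x, w) = l(w) for all w ∈ X_i. -/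
/-- A coercive bilinear form vanishes on the diagonal only at zero. -/
theorem eq_zero_of_coercive_of_apply_self_eq_zero
    {X : Type*} [NormedAddCommGroup X] [NormedSpace ℝ X]
    (b : X →ₗ[ℝ] X →ₗ[ℝ] ℝ) {γ : ℝ} (hγ : 0 < γ)
    (hcoer : ∀ u : X, γ * ‖u‖ ^ 2 ≤ b u u) {u : X} (hu : b u u = 0) : u = 0 := by
  by_contra hne
  have hpos : 0 < γ * ‖u‖ ^ 2 := mul_pos hγ (pow_pos (norm_pos_iff.mpr hne) 2)
  linarith [hcoer u]

/-- Converse of static condensation: if `y ∈ Y` solves the condensed variational formulation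
(with static condensations `s_y`, `t_l` of `A y` and `l` on `Z`, and adjoint condensations
`r_v` existing for every `v ∈ Y`), and `z ∈ Z` is the static condensation of `l - A y` on `Z`,
then `x = y + z` solves the Galerkin problem on `Y ⊔ Z`. -/
theorem condensed_implies_galerkin
    {X : Type*} [NormedAddCommGroup X] [InnerProductSpace ℝ X] [CompleteSpace X]
    (b : X →ₗ[ℝ] X →ₗ[ℝ] ℝ) (M γ : ℝ) (hγ : 0 < γ)
    (hbound : ∀ u w : X, |b u w| ≤ M * ‖u‖ * ‖w‖)
    (hcoer : ∀ u : X, γ * ‖u‖ ^ 2 ≤ b u u)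
    (l : X →L[ℝ] ℝ)
    (Y Z : Submodule ℝ X) [FiniteDimensional ℝ Y] [FiniteDimensional ℝ Z]
    (hYZ : Y ⊓ Z = ⊥)
    (y : X) (hy : y ∈ Y)
    (sy tl : X) (hsyZ : sy ∈ Z) (htlZ : tl ∈ Z)
    (hsy : ∀ w ∈ Z, b sy w = b y w)
    (htl : ∀ w ∈ Z, b tl w = l w)
    (hcond : ∀ v ∈ Y, ∀ rv ∈ Z, (∀ w ∈ Z, b rv w = b w v) →
      b y v - b rv sy = l v - b rv tl)
    (z : X) (hz : z ∈ Z) (hzeq : ∀ w ∈ Z, b z w = l w - b y w)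
    (hex : ∀ v ∈ Y, ∃ rv ∈ Z, ∀ w ∈ Z, b rv w = b w v) :
    ∀ w ∈ Y ⊔ Z, b (y + z) w = l w := by
  have hz_eq_sub : z = tl - sy := by
    have hmem : z - (tl - sy) ∈ Z := Z.sub_mem hz (Z.sub_mem htlZ hsyZ)
    have horth : ∀ w ∈ Z, b (z - (tl - sy)) w = 0 := by
      intro w hw
      rw [map_sub, map_sub, LinearMap.sub_apply, LinearMap.sub_apply,
        hzeq w hw, htl w hw, hsy w hw]
      ring
    exact sub_eq_zero.mp (eq_zero_of_coercive_of_apply_self_eq_zero b hγ hcoer (horth _ hmem))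
  intro w hw
  obtain ⟨v, hv, u, hu, rfl⟩ := Submodule.mem_sup.mp hw
  have hZ : b (y + z) u = l u := by
    rw [map_add, LinearMap.add_apply, hzeq u hu]
    ring
  have hY : b (y + z) v = l v := by
    obtain ⟨rv, hrv, h⟩ := hex v hv
    have hc := hcond v hv rv hrv h
    rw [h sy hsyZ, h tl htlZ] at hc
    rw [hz_eq_sub, map_add, map_sub, LinearMap.add_apply, LinearMap.sub_apply]
    linarith
  rw [map_add (b (y + z)), map_add l, hY, hZ]
end

section
/- Let X be a real Hilbert space, b a bilinear form on X that is bounded with constant M and coercive with constant γ > 0, l a bounded linear functional on X with operator norm ‖l‖_{X'}, and Y, Z subspaces of X with Y ∩ Z = {0} that satisfy the saturation property with constant α > 0. Suppose x = y + z with y ∈ Y, z ∈ Z solves the Galerkin problem b(x, w) = l(w) for all w ∈ Y ⊕ Z, and let c ∈ Z satisfy b(c, w) = b(y, w) for all w ∈ Z (i.e. c is the static condensation of A y on Z). Then ‖c‖_X ≤ (Mα/γ²)‖l‖_{X'}. -/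
/-- If `γ ‖u‖² ≤ t` and `t ≤ K ‖u‖` with `K ≥ 0`, then `γ ‖u‖ ≤ K`. -/
theorem mul_norm_le_of_mul_sq_le {X : Type*} [NormedAddCommGroup X] {γ t K : ℝ} {u : X}
    (hK : 0 ≤ K) (hlow : γ * ‖u‖ ^ 2 ≤ t) (hup : t ≤ K * ‖u‖) : γ * ‖u‖ ≤ K := by
  rcases (norm_nonneg u).eq_or_lt with hu | hu
  · simpa [← hu] using hK
  · exact le_of_mul_le_mul_right (by linarith [sq ‖u‖, mul_assoc γ ‖u‖ ‖u‖]) hu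

/-- On a nontrivial space the boundedness constant of a bilinear form is nonnegative. -/
theorem bilinear_bound_nonneg {X : Type*} [NormedAddCommGroup X] [NormedSpace ℝ X]
    [Nontrivial X] {b : X →ₗ[ℝ] X →ₗ[ℝ] ℝ} {M : ℝ}
    (hbound : ∀ u w : X, |b u w| ≤ M * ‖u‖ * ‖w‖) : 0 ≤ M := by
  obtain ⟨u, hu⟩ := exists_ne (0 : X)
  have hpos : 0 < ‖u‖ := norm_pos_iff.2 hu
  have h : 0 ≤ M * ‖u‖ * ‖u‖ := (abs_nonneg _).trans (hbound u u)
  exact nonneg_of_mul_nonneg_left (nonneg_of_mul_nonneg_left h hpos) hpos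

/-- A posteriori stabilization bound: if `(Y, Z)` satisfies the saturation property with
constant `α > 0`, `x = y + z` solves the Galerkin problem for a bounded (constant `M`) and
coercive (constant `γ > 0`) bilinear form `b` and a bounded linear functional `l`, and
`c ∈ Z` is the static condensation of `A y` on `Z`, then `‖c‖ ≤ (M * α / γ ^ 2) * ‖l‖`. -/
theorem static_condensation_bound
    {X : Type*} [NormedAddCommGroup X] [InnerProductSpace ℝ X] [CompleteSpace X]
    (b : X →ₗ[ℝ] X →ₗ[ℝ] ℝ) (M γ : ℝ) (hγ : 0 < γ)
    (hbound : ∀ u w : X, |b u w| ≤ M * ‖u‖ * ‖w‖)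
    (hcoer : ∀ u : X, γ * ‖u‖ ^ 2 ≤ b u u)
    (l : X →L[ℝ] ℝ)
    (Y Z : Submodule ℝ X) (hYZ : Y ⊓ Z = ⊥)
    (α : ℝ) (hα : 0 < α)
    (hsat : ∀ y ∈ Y, ∀ z ∈ Z, ‖y‖ + ‖z‖ ≤ α * ‖y + z‖)
    (y z : X) (hy : y ∈ Y) (hz : z ∈ Z)
    (hGal : ∀ w ∈ Y ⊔ Z, b (y + z) w = l w)
    (c : X) (hc : c ∈ Z) (hcond : ∀ w ∈ Z, b c w = b y w) :
    ‖c‖ ≤ (M * α / γ ^ 2) * ‖l‖ := by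
  rcases subsingleton_or_nontrivial X with hX | hX
  · rw [Subsingleton.elim c 0, Subsingleton.elim l 0]
    simp
  have hM : 0 ≤ M := bilinear_bound_nonneg hbound
  have hx : γ * ‖y + z‖ ≤ ‖l‖ := by
    refine mul_norm_le_of_mul_sq_le (norm_nonneg l) (hcoer (y + z)) ?_
    rw [hGal (y + z) (Submodule.add_mem_sup hy hz)]
    exact (le_abs_self _).trans (l.le_opNorm _)
  have hcy : γ * ‖c‖ ≤ M * ‖y‖ := by
    refine mul_norm_le_of_mul_sq_le (by positivity) (hcoer c) ?_
    rw [hcond c hc]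
    exact (le_abs_self _).trans (hbound y c)
  have hyx : ‖y‖ ≤ α * ‖y + z‖ := by linarith [hsat y hy z hz, norm_nonneg z]
  rw [div_mul_eq_mul_div, le_div_iff₀ (by positivity)]
  calc ‖c‖ * γ ^ 2 = γ * (γ * ‖c‖) := by ring
    _ ≤ γ * (M * (α * ‖y + z‖)) :=
      mul_le_mul_of_nonneg_left (hcy.trans (mul_le_mul_of_nonneg_left hyx hM)) hγ.le
    _ = M * α * (γ * ‖y + z‖) := by ring
    _ ≤ M * α * ‖l‖ := by gcongr
end
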